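/- Let P ∈ ℝ[X₁,…,X_k] and a ∈ ℕ. Then P has additive complexity at most a if and only if there exist POLYNOMIALS Q₁,…,Q_a ∈ ℝ[X₁,…,X_k], reals u_j, v_j (1 ≤ j ≤ a) and c, natural-number exponents α_{ji}, β_{ji} (1 ≤ j ≤ a, 1 ≤ i ≤ k) and γ_{ji}, δ_{ji} (1 ≤ i < j ≤ a), and INTEGER exponents ζ₁,…,ζ_k and η₁,…,η_a, such that: (i) Q₁ = u₁X₁^{α₁₁}⋯X_k^{α₁k} + v₁X₁^{β₁₁}⋯X_k^{β₁k}; (ii) for 1 < j ≤ a, Q_j = u_jX₁^{α_{j1}}⋯X_k^{α_{jk}}∏_{i<j}Q_i^{γ_{ji}} + v_jX₁^{β_{j1}}⋯X_k^{β_{jk}}∏_{i<j}Q_i^{δ_{ji}}; and (iii) in the fraction field ℝ(X₁,…,X_k), P = c·X₁^{ζ₁}⋯X_k^{ζ_k}·∏_{j=1}^a Q_j^{η_j}, where negative integer powers are taken in the fraction field. (In other words, any additive representation of P can be replaced by one of the same length in which negative exponents occur only in the final step.) -/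

import Mathlib

open MvPolynomial

/-- `P` has division-free additive complexity at most `a`: there is a
straight-line sequence `Q₁,…,Q_a` of polynomials, each a sum of two terms built
from monomials (with natural-number exponents) and earlier `Q_i`'s, such that
`P` is a constant times a monomial times a product of powers of the `Q_j`'s. -/
def DivFreeAddCompLE {σ : Type} [Fintype σ] (a : ℕ) (P : MvPolynomial σ ℝ) : Prop :=
  ∃ (Q : Fin a → MvPolynomial σ ℝ) (u v : Fin a → ℝ)
    (α β : Fin a → σ → ℕ) (γ δ : Fin a → Fin a → ℕ)
    (c : ℝ) (ζ : σ → ℕ) (η : Fin a → ℕ),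
    (∀ j : Fin a,
      Q j = MvPolynomial.C (u j) * (∏ i, MvPolynomial.X i ^ α j i) *
              (∏ i ∈ Finset.univ.filter (· < j), Q i ^ γ j i)
          + MvPolynomial.C (v j) * (∏ i, MvPolynomial.X i ^ β j i) *
              (∏ i ∈ Finset.univ.filter (· < j), Q i ^ δ j i)) ∧
    P = MvPolynomial.C c * (∏ i, MvPolynomial.X i ^ ζ i) * ∏ j, Q j ^ η j

/-- `P` has additive complexity at most `a`: same as division-free additive
complexity, but the intermediate quantities `Q₁,…,Q_a` live in the fraction
field and all exponents are integers (negative powers in the fraction field). -/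
def AddCompLE {σ : Type} [Fintype σ] (a : ℕ) (P : MvPolynomial σ ℝ) : Prop :=
  ∃ (Q : Fin a → FractionRing (MvPolynomial σ ℝ)) (u v : Fin a → ℝ)
    (α β : Fin a → σ → ℤ) (γ δ : Fin a → Fin a → ℤ)
    (c : ℝ) (ζ : σ → ℤ) (η : Fin a → ℤ),
    (∀ j : Fin a,
      Q j = algebraMap (MvPolynomial σ ℝ) (FractionRing (MvPolynomial σ ℝ))
              (MvPolynomial.C (u j)) *
            (∏ i, (algebraMap (MvPolynomial σ ℝ) (FractionRing (MvPolynomial σ ℝ))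
              (MvPolynomial.X i)) ^ α j i) *
            (∏ i ∈ Finset.univ.filter (· < j), Q i ^ γ j i)
          + algebraMap (MvPolynomial σ ℝ) (FractionRing (MvPolynomial σ ℝ))
              (MvPolynomial.C (v j)) *
            (∏ i, (algebraMap (MvPolynomial σ ℝ) (FractionRing (MvPolynomial σ ℝ))
              (MvPolynomial.X i)) ^ β j i) *
            (∏ i ∈ Finset.univ.filter (· < j), Q i ^ δ j i)) ∧
    algebraMap (MvPolynomial σ ℝ) (FractionRing (MvPolynomial σ ℝ)) P =
      algebraMap (MvPolynomial σ ℝ) (FractionRing (MvPolynomial σ ℝ))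
        (MvPolynomial.C c) *
      (∏ i, (algebraMap (MvPolynomial σ ℝ) (FractionRing (MvPolynomial σ ℝ))
        (MvPolynomial.X i)) ^ ζ i) *
      ∏ j, Q j ^ η j

section LaurentMonomials

variable {F A K ι : Type*} [Field F] [CommRing A] [Field K] [Algebra A K] [Algebra F K]
  [Fintype ι]

variable (F K) in
/-- The submonoid of `K` consisting of the scalar multiples of products of integer powers of those
`g i` with `i ∈ s` that are nonzero. -/
def laurentMonomials (g : ι → A) (s : Set ι) : Submonoid K where
  carrier := {x | ∃ (c : F) (e : ι → ℤ), (∀ i, e i ≠ 0 → i ∈ s ∧ algebraMap A K (g i) ≠ 0) ∧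
    x = algebraMap F K c * ∏ i, algebraMap A K (g i) ^ e i}
  one_mem' := ⟨1, 0, by simp, by simp⟩
  mul_mem' := by
    rintro _ _ ⟨c, e, he, rfl⟩ ⟨d, f, hf, rfl⟩
    refine ⟨c * d, e + f, fun i hi => ?_, ?_⟩
    · by_cases h : e i = 0
      · exact hf i fun h' => hi (by simp [h, h'])
      · exact he i h
    · have h (i : ι) : algebraMap A K (g i) ^ (e + f) i =
          algebraMap A K (g i) ^ e i * algebraMap A K (g i) ^ f i := by
        by_cases h0 : algebraMap A K (g i) = 0
        · have h1 : e i = 0 := by_contra fun h => (he i h).2 h0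
          have h2 : f i = 0 := by_contra fun h => (hf i h).2 h0
          simp [h1, h2]
        · exact zpow_add₀ h0 _ _
      simp_rw [h, Finset.prod_mul_distrib, map_mul]
      ring

namespace laurentMonomials

variable {g g' : ι → A} {s t : Set ι}

theorem algebraMap_mem (c : F) : algebraMap F K c ∈ laurentMonomials F K g s :=
  ⟨c, 0, by simp, by simp⟩

theorem gen_mem {i : ι} (hi : i ∈ s) : algebraMap A K (g i) ∈ laurentMonomials F K g s := by
  classical
  by_cases h0 : algebraMap A K (g i) = 0
  · rw [h0, ← map_zero (algebraMap F K)]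
    exact algebraMap_mem 0
  · refine ⟨1, Pi.single i 1, fun j hj => ?_, ?_⟩
    · obtain rfl : j = i := by_contra fun h => hj (by simp [h])
      exact ⟨hi, h0⟩
    · rw [Finset.prod_eq_single i (fun j _ hj => by simp [hj]) (by simp)]
      simp

theorem inv_mem {x : K} (hx : x ∈ laurentMonomials F K g s) :
    x⁻¹ ∈ laurentMonomials F K g s := by
  obtain ⟨c, e, he, rfl⟩ := hx
  exact ⟨c⁻¹, -e, by simpa using he, by simp [mul_comm]⟩

theorem zpow_mem {x : K} (hx : x ∈ laurentMonomials F K g s) (n : ℤ) :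
    x ^ n ∈ laurentMonomials F K g s := by
  cases n with
  | ofNat n => simpa using pow_mem hx n
  | negSucc n => rw [zpow_negSucc]; exact inv_mem (pow_mem hx _)

theorem mono_congr (hst : s ⊆ t) (hg : ∀ i ∈ s, g i = g' i) :
    laurentMonomials F K g s ≤ laurentMonomials F K g' t := by
  rintro _ ⟨c, e, he, rfl⟩
  refine ⟨c, e, fun i hi => ?_, ?_⟩
  · obtain ⟨h1, h2⟩ := he i hi
    exact ⟨hst h1, hg i h1 ▸ h2⟩
  · congr 1
    refine Finset.prod_congr rfl fun i _ => ?_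
    by_cases h : e i = 0
    · simp [h]
    · rw [hg i (he i h).1]

/-- The sum of two Laurent monomials is, up to a Laurent monomial, a sum of two monomials with
nonnegative exponents. -/
theorem exists_add_eq_mul [Algebra F A] [IsScalarTower F A K] {x y : K}
    (hx : x ∈ laurentMonomials F K g s) (hy : y ∈ laurentMonomials F K g s) :
    ∃ z ∈ laurentMonomials F K g s, ∃ (u v : F) (e f : ι → ℕ),
      (∀ i, e i ≠ 0 → i ∈ s) ∧ (∀ i, f i ≠ 0 → i ∈ s) ∧
      x + y = z * algebraMap A K
        (algebraMap F A u * ∏ i, g i ^ e i + algebraMap F A v * ∏ i, g i ^ f i) := by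
  obtain ⟨c, e, he, rfl⟩ := hx
  obtain ⟨d, f, hf, rfl⟩ := hy
  have split (e m : ι → ℤ) (hm : ∀ i, m i ≤ e i)
      (h0 : ∀ i, algebraMap A K (g i) = 0 → e i = 0 ∧ m i = 0) :
      ∏ i, algebraMap A K (g i) ^ e i = (∏ i, algebraMap A K (g i) ^ m i) *
        ∏ i, algebraMap A K (g i) ^ (e i - m i).toNat := by
    rw [← Finset.prod_mul_distrib]
    refine Finset.prod_congr rfl fun i _ => ?_
    by_cases h : algebraMap A K (g i) = 0
    · simp [h0 i h]
    · rw [← zpow_natCast, ← zpow_add₀ h]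
      congr 1
      have := hm i
      lia
  have he0 (i : ι) (h : algebraMap A K (g i) = 0) : e i = 0 :=
    by_contra fun h' => (he i h').2 h
  have hf0 (i : ι) (h : algebraMap A K (g i) = 0) : f i = 0 :=
    by_contra fun h' => (hf i h').2 h
  have hs (i : ι) (h : i ∉ s) : e i = 0 ∧ f i = 0 :=
    ⟨by_contra fun h' => h (he i h').1, by_contra fun h' => h (hf i h').1⟩
  refine ⟨∏ i, algebraMap A K (g i) ^ min (e i) (f i), ⟨1, fun i => min (e i) (f i), ?_, by simp⟩,
    c, d, fun i => (e i - min (e i) (f i)).toNat, fun i => (f i - min (e i) (f i)).toNat,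
    fun i hi => ?_, fun i hi => ?_, ?_⟩
  · intro i hi
    by_cases h : e i = 0
    · exact hf i fun h' => hi (by simp [h, h'])
    · exact he i h
  · by_contra h
    exact hi (by simp [hs i h])
  · by_contra h
    exact hi (by simp [hs i h])
  · rw [split e (fun i => min (e i) (f i)) (by simp) fun i h => by simp [he0 i h, hf0 i h],
      split f (fun i => min (e i) (f i)) (by simp) fun i h => by simp [he0 i h, hf0 i h]]
    simp only [map_add, map_mul, map_prod, map_pow, ← IsScalarTower.algebraMap_apply]
    ring

end laurentMonomials

end LaurentMonomials

/-- Entry `j` of `Q` is a sum of two terms built from monomials and earlier entries of `Q`. -/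
def IsAdditiveStep {σ : Type} [Fintype σ] {a : ℕ} (Q : Fin a → MvPolynomial σ ℝ) (j : Fin a) :
    Prop :=
  ∃ (u v : ℝ) (α β : σ → ℕ) (γ δ : Fin a → ℕ),
    Q j = C u * (∏ i, X i ^ α i) * (∏ i ∈ Finset.univ.filter (· < j), Q i ^ γ i)
        + C v * (∏ i, X i ^ β i) * (∏ i ∈ Finset.univ.filter (· < j), Q i ^ δ i)

theorem IsAdditiveStep.congr {σ : Type} [Fintype σ] {a : ℕ} {Q Q' : Fin a → MvPolynomial σ ℝ}
    {j : Fin a} (h : IsAdditiveStep Q j) (hQ : ∀ i ≤ j, Q' i = Q i) : IsAdditiveStep Q' j := by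
  obtain ⟨u, v, α, β, γ, δ, h⟩ := h
  have hprod (γ : Fin a → ℕ) : ∏ i ∈ Finset.univ.filter (· < j), Q' i ^ γ i =
      ∏ i ∈ Finset.univ.filter (· < j), Q i ^ γ i :=
    Finset.prod_congr rfl fun i hi => by rw [hQ i (Finset.mem_filter.1 hi).2.le]
  exact ⟨u, v, α, β, γ, δ, by rw [hQ j le_rfl, hprod, hprod, h]⟩

/-- The indices of the variables and of the first `n` intermediate polynomials. -/
def initialIndices (σ : Type) (a n : ℕ) : Set (σ ⊕ Fin a) :=
  {i | ∀ j, i = Sum.inr j → j.val < n}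

theorem exists_polynomial_steps {σ : Type} [Fintype σ] {a : ℕ}
    (Q : Fin a → FractionRing (MvPolynomial σ ℝ)) (u v : Fin a → ℝ)
    (α β : Fin a → σ → ℤ) (γ δ : Fin a → Fin a → ℤ)
    (hQ : ∀ j : Fin a,
      Q j = algebraMap (MvPolynomial σ ℝ) (FractionRing (MvPolynomial σ ℝ)) (C (u j)) *
            (∏ i, (algebraMap (MvPolynomial σ ℝ) (FractionRing (MvPolynomial σ ℝ)) (X i)) ^ α j i) *
            (∏ i ∈ Finset.univ.filter (· < j), Q i ^ γ j i)
          + algebraMap (MvPolynomial σ ℝ) (FractionRing (MvPolynomial σ ℝ)) (C (v j)) *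
            (∏ i, (algebraMap (MvPolynomial σ ℝ) (FractionRing (MvPolynomial σ ℝ)) (X i)) ^ β j i) *
            (∏ i ∈ Finset.univ.filter (· < j), Q i ^ δ j i))
    (n : ℕ) (hn : n ≤ a) :
    ∃ Q' : Fin a → MvPolynomial σ ℝ, (∀ j, j.val < n → IsAdditiveStep Q' j) ∧
      ∀ j, j.val < n → Q j ∈ laurentMonomials ℝ (FractionRing (MvPolynomial σ ℝ))
        (Sum.elim X Q') (initialIndices σ a n) := by
  induction n with
  | zero => exact ⟨0, by simp, by simp⟩
  | succ n ih =>
    obtain ⟨Q', hstep, hmem⟩ := ih (by lia)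
    let j : Fin a := ⟨n, hn⟩
    have term_mem (c : ℝ) (e : σ → ℤ) (f : Fin a → ℤ) :
        algebraMap (MvPolynomial σ ℝ) (FractionRing (MvPolynomial σ ℝ)) (C c) *
          (∏ i, (algebraMap (MvPolynomial σ ℝ) (FractionRing (MvPolynomial σ ℝ)) (X i)) ^ e i) *
          (∏ i ∈ Finset.univ.filter (· < j), Q i ^ f i) ∈
        laurentMonomials ℝ (FractionRing (MvPolynomial σ ℝ))
          (Sum.elim X Q') (initialIndices σ a n) := by
      refine mul_mem (mul_mem ?_ (prod_mem fun i _ => ?_)) (prod_mem fun i hi => ?_)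
      · rw [← MvPolynomial.algebraMap_eq, ← IsScalarTower.algebraMap_apply]
        exact laurentMonomials.algebraMap_mem c
      · refine laurentMonomials.zpow_mem ?_ _
        exact laurentMonomials.gen_mem (g := Sum.elim X Q') (i := Sum.inl i)
          (by simp [initialIndices])
      · exact laurentMonomials.zpow_mem (hmem i (Finset.mem_filter.1 hi).2) _
    obtain ⟨z, hz, c, d, e, f, he, hf, heq⟩ := laurentMonomials.exists_add_eq_mul
      (term_mem (u j) (α j) (γ j)) (term_mem (v j) (β j) (δ j))
    rw [← hQ j] at heq
    set p := algebraMap ℝ (MvPolynomial σ ℝ) c * ∏ i, Sum.elim X Q' i ^ e i +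
      algebraMap ℝ (MvPolynomial σ ℝ) d * ∏ i, Sum.elim X Q' i ^ f i with hp
    have hlt (i : Fin a) (hi : i.val < n) : Function.update Q' j p i = Q' i :=
      Function.update_of_ne (fun h => by simp [h, j] at hi) _ _
    have hle : laurentMonomials ℝ (FractionRing (MvPolynomial σ ℝ))
          (Sum.elim X Q') (initialIndices σ a n) ≤
        laurentMonomials ℝ (FractionRing (MvPolynomial σ ℝ))
          (Sum.elim X (Function.update Q' j p)) (initialIndices σ a (n + 1)) := by
      refine laurentMonomials.mono_congr (fun i hi k hk => (hi k hk).trans n.lt_succ_self) ?_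
      rintro (i | i) hi
      · rfl
      · exact (hlt i (hi i rfl)).symm
    refine ⟨Function.update Q' j p, fun i hi => ?_, fun i hi => ?_⟩
    · obtain hi | hi := Nat.lt_succ_iff_lt_or_eq.1 hi
      · exact (hstep i hi).congr fun l hl => hlt l (lt_of_le_of_lt hl hi)
      · obtain rfl : i = j := Fin.ext hi
        have hprod (e : σ ⊕ Fin a → ℕ) (he : ∀ i, e i ≠ 0 → i ∈ initialIndices σ a n) :
            ∏ l, Sum.elim X Q' l ^ e l = (∏ l, X l ^ e (Sum.inl l)) *
              ∏ l ∈ Finset.univ.filter (· < j),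
                Function.update Q' j p l ^ e (Sum.inr l) := by
          rw [Fintype.prod_sum_type]
          congr 1
          rw [Finset.prod_filter]
          refine Finset.prod_congr rfl fun l _ => ?_
          split_ifs with hl
          · rw [hlt l hl, Sum.elim_inr]
          · have : e (Sum.inr l) = 0 := by_contra fun h => hl (Fin.lt_def.2 (he _ h l rfl))
            simp [this]
        refine ⟨c, d, e ∘ Sum.inl, f ∘ Sum.inl, e ∘ Sum.inr, f ∘ Sum.inr, ?_⟩
        rw [Function.update_self]
        conv_lhs => rw [hp, hprod e he, hprod f hf]
        simp only [MvPolynomial.algebraMap_eq, mul_assoc, Function.comp_apply]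
    · obtain hi | hi := Nat.lt_succ_iff_lt_or_eq.1 hi
      · exact hle (hmem i hi)
      · obtain rfl : i = j := Fin.ext hi
        rw [heq]
        refine mul_mem (hle hz) ?_
        have := laurentMonomials.gen_mem (F := ℝ) (K := FractionRing (MvPolynomial σ ℝ))
          (g := Sum.elim X (Function.update Q' j p)) (s := initialIndices σ a (n + 1))
          (i := Sum.inr j) (by simp [initialIndices, j])
        simpa using this

/-- a polynomial `P` has additive complexity at most `a` iff it
admits an additive representation of length `a` in which the intermediate
quantities `Q₁,…,Q_a` are honest polynomials with natural-number exponents and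
negative (integer) exponents occur only in the final step, taken in the
fraction field. -/
theorem stmt15 (k a : ℕ) (P : MvPolynomial (Fin k) ℝ) :
    AddCompLE a P ↔
    ∃ (Q : Fin a → MvPolynomial (Fin k) ℝ) (u v : Fin a → ℝ)
      (α β : Fin a → Fin k → ℕ) (γ δ : Fin a → Fin a → ℕ)
      (c : ℝ) (ζ : Fin k → ℤ) (η : Fin a → ℤ),
      (∀ j : Fin a,
        Q j = MvPolynomial.C (u j) * (∏ i, MvPolynomial.X i ^ α j i) *
                (∏ i ∈ Finset.univ.filter (· < j), Q i ^ γ j i)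
            + MvPolynomial.C (v j) * (∏ i, MvPolynomial.X i ^ β j i) *
                (∏ i ∈ Finset.univ.filter (· < j), Q i ^ δ j i)) ∧
      algebraMap (MvPolynomial (Fin k) ℝ) (FractionRing (MvPolynomial (Fin k) ℝ)) P =
        algebraMap (MvPolynomial (Fin k) ℝ) (FractionRing (MvPolynomial (Fin k) ℝ))
          (MvPolynomial.C c) *
        (∏ i, (algebraMap (MvPolynomial (Fin k) ℝ)
          (FractionRing (MvPolynomial (Fin k) ℝ)) (MvPolynomial.X i)) ^ ζ i) *
        ∏ j, (algebraMap (MvPolynomial (Fin k) ℝ)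
          (FractionRing (MvPolynomial (Fin k) ℝ)) (Q j)) ^ η j := by
  constructor
  · rintro ⟨Q, u, v, α, β, γ, δ, c, ζ, η, hQ, hP⟩
    obtain ⟨Q', hstep, hmem⟩ := exists_polynomial_steps Q u v α β γ δ hQ a le_rfl
    have hP_mem : algebraMap _ (FractionRing (MvPolynomial (Fin k) ℝ)) P ∈
        laurentMonomials ℝ (FractionRing (MvPolynomial (Fin k) ℝ))
          (Sum.elim X Q') (initialIndices (Fin k) a a) := by
      rw [hP]
      refine mul_mem (mul_mem ?_ (prod_mem fun i _ => ?_)) (prod_mem fun i _ => ?_)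
      · rw [← MvPolynomial.algebraMap_eq, ← IsScalarTower.algebraMap_apply]
        exact laurentMonomials.algebraMap_mem c
      · refine laurentMonomials.zpow_mem ?_ _
        exact laurentMonomials.gen_mem (g := Sum.elim X Q') (i := Sum.inl i)
          (by simp [initialIndices])
      · exact laurentMonomials.zpow_mem (hmem i i.isLt) _
    obtain ⟨c', e, -, he⟩ := hP_mem
    choose u' v' α' β' γ' δ' h using fun j : Fin a => hstep j j.isLt
    refine ⟨Q', u', v', α', β', γ', δ', c', e ∘ Sum.inl, e ∘ Sum.inr, h, ?_⟩
    rw [he, Fintype.prod_sum_type, ← MvPolynomial.algebraMap_eq,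
      ← IsScalarTower.algebraMap_apply, mul_assoc]
    rfl
  · rintro ⟨Q, u, v, α, β, γ, δ, c, ζ, η, hQ, hP⟩
    refine ⟨fun j => algebraMap _ _ (Q j), u, v, fun j i => α j i, fun j i => β j i,
      fun j i => γ j i, fun j i => δ j i, c, ζ, η, fun j => ?_, hP⟩
    simpa only [map_add, map_mul, map_prod, map_pow, zpow_natCast] using
      congrArg (algebraMap _ (FractionRing (MvPolynomial (Fin k) ℝ))) (hQ j)
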